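/- Let m ≥ 1 be an integer, let α > -1 be real, and let q = (q_1, …, q_m) be a vector of positive real numbers. Then the integral over the open simplex {x ∈ ℝ^m : x_i > 0 for all i and x_1 + ⋯ + x_m < 1} of the function (1 - Σ_{i=1}^m x_i)^α · ∏_{i=1}^m x_i^{q_i} with respect to Lebesgue measure exists and equals (∏_{i=1}^m Γ(q_i + 1)) · Γ(α + 1) / Γ(α + Σ_{i=1}^m q_i + m + 1). -/

import Mathlib

open MeasureTheory

noncomputable section

/-- The open simplex of size `s` in `ℝ^m`. -/
def openSimplex (m : ℕ) (s : ℝ) : Set (Fin m → ℝ) :=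
  {x | (∀ i, 0 < x i) ∧ ∑ i, x i < s}

lemma measurableSet_openSimplex (m : ℕ) (s : ℝ) : MeasurableSet (openSimplex m s) := by
  refine MeasurableSet.inter (s₁ := {x : Fin m → ℝ | ∀ i, 0 < x i})
    (s₂ := {x : Fin m → ℝ | ∑ i, x i < s}) ?_ ?_
  · rw [Set.ofPred_forall]
    exact MeasurableSet.iInter fun i => measurableSet_lt measurable_const (measurable_pi_apply i)
  · exact measurableSet_lt (by fun_prop) measurable_const

/-- Euler's beta integral over `(0, 1)`, as a lower Lebesgue integral. -/
lemma lintegral_rpow_mul_one_sub_rpow {a b : ℝ} (ha : -1 < a) (hb : -1 < b) :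
    ∫⁻ x in Set.Ioo (0 : ℝ) 1, ENNReal.ofReal (x ^ a * (1 - x) ^ b) =
      ENNReal.ofReal (ProbabilityTheory.beta (a + 1) (b + 1)) := by
  have hB : 0 < ProbabilityTheory.beta (a + 1) (b + 1) :=
    ProbabilityTheory.beta_pos (by linarith) (by linarith)
  have h := ProbabilityTheory.lintegral_betaPDF_eq_one (α := a + 1) (β := b + 1)
    (by linarith) (by linarith)
  simp only [ProbabilityTheory.lintegral_betaPDF, add_sub_cancel_right, mul_assoc,
    ENNReal.ofReal_mul (one_div_pos.2 hB).le] at h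
  rw [lintegral_const_mul _ (by fun_prop)] at h
  calc
    _ = ENNReal.ofReal (ProbabilityTheory.beta (a + 1) (b + 1)) *
          (ENNReal.ofReal (1 / ProbabilityTheory.beta (a + 1) (b + 1)) *
            ∫⁻ x in Set.Ioo (0 : ℝ) 1, ENNReal.ofReal (x ^ a * (1 - x) ^ b)) := by
      rw [← mul_assoc, ← ENNReal.ofReal_mul hB.le, mul_one_div_cancel hB.ne',
        ENNReal.ofReal_one, one_mul]
    _ = _ := by rw [h, mul_one]

/-- Euler's beta integral over `(0, s)`, as a lower Lebesgue integral. -/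
lemma lintegral_rpow_mul_sub_rpow {a b s : ℝ} (ha : -1 < a) (hb : -1 < b) (hs : 0 < s) :
    ∫⁻ x in Set.Ioo (0 : ℝ) s, ENNReal.ofReal (x ^ a * (s - x) ^ b) =
      ENNReal.ofReal (s ^ (a + b + 1) * ProbabilityTheory.beta (a + 1) (b + 1)) := by
  have himage : Set.Ioo (0 : ℝ) s = (s * ·) '' Set.Ioo 0 1 := by
    rw [Set.image_mul_left_Ioo hs, mul_zero, mul_one]
  rw [himage, lintegral_image_eq_lintegral_abs_deriv_mul (f' := fun _ => s) measurableSet_Ioo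
    (fun x _ => by simpa using ((hasDerivAt_id x).const_mul s).hasDerivWithinAt)
    (mul_right_injective₀ hs.ne').injOn, ENNReal.ofReal_mul (by positivity),
    ← lintegral_rpow_mul_one_sub_rpow ha hb, ← lintegral_const_mul _ (by fun_prop)]
  refine setLIntegral_congr_fun measurableSet_Ioo fun x ⟨hx0, hx1⟩ => ?_
  have h1x : 0 ≤ 1 - x := by linarith
  rw [← ENNReal.ofReal_mul (abs_nonneg s), ← ENNReal.ofReal_mul (by positivity), abs_of_pos hs,
    ← mul_one_sub, Real.mul_rpow hs.le hx0.le, Real.mul_rpow hs.le h1x, Real.rpow_add hs,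
    Real.rpow_add hs, Real.rpow_one]
  congr 1
  ring

lemma cons_mem_openSimplex_iff {m : ℕ} {s t : ℝ} {y : Fin m → ℝ} :
    (Fin.cons t y : Fin (m + 1) → ℝ) ∈ openSimplex (m + 1) s ↔
      t ∈ Set.Ioo 0 s ∧ y ∈ openSimplex m (s - t) := by
  simp only [openSimplex, Set.mem_ofPred_eq, Fin.forall_fin_succ, Fin.cons_zero, Fin.cons_succ,
    Fin.sum_univ_succ, Set.mem_Ioo]
  constructor
  · rintro ⟨⟨ht, hy⟩, hsum⟩
    have : 0 ≤ ∑ i, y i := Finset.sum_nonneg fun i _ => (hy i).le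
    exact ⟨⟨ht, by linarith⟩, hy, by linarith⟩
  · rintro ⟨⟨ht, _⟩, hy, hsum⟩
    exact ⟨⟨ht, hy⟩, by linarith⟩

/-- Tonelli's theorem on the open simplex, integrating the first coordinate last. -/
lemma lintegral_openSimplex_succ {m : ℕ} {s : ℝ} {f : (Fin (m + 1) → ℝ) → ENNReal}
    (hf : Measurable f) :
    ∫⁻ x in openSimplex (m + 1) s, f x =
      ∫⁻ t in Set.Ioo 0 s, ∫⁻ y in openSimplex m (s - t), f (Fin.cons t y) := by
  have hmeas := hf.indicator (measurableSet_openSimplex (m + 1) s)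
  have e := (volume_preserving_piFinSuccAbove (fun _ : Fin (m + 1) => ℝ) 0).symm
  rw [← lintegral_indicator (measurableSet_openSimplex _ _),
    ← lintegral_indicator measurableSet_Ioo, ← e.lintegral_comp hmeas, Measure.volume_eq_prod,
    lintegral_prod _ (by exact (hmeas.comp e.measurable).aemeasurable)]
  refine lintegral_congr fun t => ?_
  have hcons (y : Fin m → ℝ) :
      (MeasurableEquiv.piFinSuccAbove (fun _ : Fin (m + 1) => ℝ) 0).symm (t, y) =
        (Fin.cons t y : Fin (m + 1) → ℝ) := by
    simp [MeasurableEquiv.piFinSuccAbove, Fin.consEquiv]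
  simp only [hcons]
  by_cases ht : t ∈ Set.Ioo 0 s
  · rw [Set.indicator_of_mem ht, ← lintegral_indicator (measurableSet_openSimplex _ _)]
    refine lintegral_congr fun y => ?_
    by_cases hy : y ∈ openSimplex m (s - t)
    · rw [Set.indicator_of_mem hy, Set.indicator_of_mem (cons_mem_openSimplex_iff.2 ⟨ht, hy⟩)]
    · rw [Set.indicator_of_notMem hy,
        Set.indicator_of_notMem fun h => hy (cons_mem_openSimplex_iff.1 h).2]
  · simp [Set.indicator, cons_mem_openSimplex_iff, ht]

lemma lintegral_dirichlet (m : ℕ) {α : ℝ} (hα : -1 < α) {q : Fin m → ℝ} (hq : ∀ i, -1 < q i)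
    {s : ℝ} (hs : 0 < s) :
    ∫⁻ x in openSimplex m s, ENNReal.ofReal ((s - ∑ i, x i) ^ α * ∏ i, x i ^ q i) =
      ENNReal.ofReal (s ^ (α + (∑ i, q i) + m) * ((∏ i, Real.Gamma (q i + 1)) *
        Real.Gamma (α + 1) / Real.Gamma (α + (∑ i, q i) + m + 1))) := by
  induction m generalizing s with
  | zero =>
    have huniv : openSimplex 0 s = Set.univ := by
      ext x
      simp [openSimplex, hs]
    have hΓ : Real.Gamma (α + 1) ≠ 0 := (Real.Gamma_pos_of_pos (by linarith)).ne'
    simp [huniv, div_self hΓ, volume_pi]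
  | succ m ih =>
    rw [lintegral_openSimplex_succ (by fun_prop)]
    set Q := ∑ i : Fin m, q i.succ with hQ
    have hQm : -(m : ℝ) ≤ Q := by
      have := Finset.sum_le_sum (s := Finset.univ) fun (i : Fin m) _ => (hq i.succ).le
      simpa using this
    have hβ : -1 < α + Q + m := by linarith
    have hΓβ : 0 < Real.Gamma (α + Q + m + 1) := Real.Gamma_pos_of_pos (by linarith)
    set C := (∏ i : Fin m, Real.Gamma (q i.succ + 1)) * Real.Gamma (α + 1) /
      Real.Gamma (α + Q + m + 1) with hC
    have hC0 : 0 ≤ C := by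
      have hprod : 0 ≤ ∏ i : Fin m, Real.Gamma (q i.succ + 1) :=
        Finset.prod_nonneg fun i _ => (Real.Gamma_pos_of_pos (by linarith [hq i.succ])).le
      have hΓα : 0 < Real.Gamma (α + 1) := Real.Gamma_pos_of_pos (by linarith)
      positivity
    have hinner : ∀ t ∈ Set.Ioo 0 s,
        ∫⁻ y in openSimplex m (s - t), ENNReal.ofReal
          ((s - ∑ i, (Fin.cons t y : Fin (m + 1) → ℝ) i) ^ α *
            ∏ i, (Fin.cons t y : Fin (m + 1) → ℝ) i ^ q i) =
          ENNReal.ofReal C * ENNReal.ofReal (t ^ q 0 * (s - t) ^ (α + Q + m)) := by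
      rintro t ⟨ht0, hts⟩
      have htq : 0 ≤ t ^ q 0 := by positivity
      simp only [Fin.sum_univ_succ, Fin.prod_univ_succ, Fin.cons_zero, Fin.cons_succ, ← sub_sub,
        mul_left_comm _ (t ^ q 0), ENNReal.ofReal_mul htq]
      rw [lintegral_const_mul _ (by fun_prop), ih (fun i => hq i.succ) (sub_pos.2 hts), ← hQ,
        ← hC, mul_comm _ C, ENNReal.ofReal_mul hC0, mul_left_comm]
    rw [setLIntegral_congr_fun measurableSet_Ioo hinner, lintegral_const_mul _ (by fun_prop),
      lintegral_rpow_mul_sub_rpow (hq 0) hβ hs, ← ENNReal.ofReal_mul hC0]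
    simp only [Fin.sum_univ_succ, Fin.prod_univ_succ, ← hQ, ProbabilityTheory.beta, hC,
      Nat.cast_succ]
    rw [show α + (q 0 + Q) + (m + 1) = q 0 + (α + Q + m) + 1 by ring,
      show q 0 + 1 + (α + Q + m + 1) = q 0 + (α + Q + m) + 1 + 1 by ring]
    congr 1
    field_simp

/-- For an integer `m ≥ 1`, real `α > -1` and a vector `q` of positive reals,
the integral over the open simplex `{x ∈ ℝ^m : xᵢ > 0, ∑ xᵢ < 1}` of
`(1 - ∑ xᵢ)^α ∏ xᵢ^{qᵢ}` exists and equals `(∏ Γ(qᵢ+1)) Γ(α+1) / Γ(α + ∑ qᵢ + m + 1)`. -/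
theorem stmt0 (m : ℕ) (hm : 1 ≤ m) (α : ℝ) (hα : -1 < α)
    (q : Fin m → ℝ) (hq : ∀ i, 0 < q i) :
    IntegrableOn (fun x : Fin m → ℝ => (1 - ∑ i, x i) ^ α * ∏ i, x i ^ q i)
      {x : Fin m → ℝ | (∀ i, 0 < x i) ∧ ∑ i, x i < 1} volume ∧
    ∫ x in {x : Fin m → ℝ | (∀ i, 0 < x i) ∧ ∑ i, x i < 1},
        (1 - ∑ i, x i) ^ α * ∏ i, x i ^ q i =
      (∏ i, Real.Gamma (q i + 1)) * Real.Gamma (α + 1) /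
        Real.Gamma (α + (∑ i, q i) + m + 1) := by
  set f := fun x : Fin m → ℝ => (1 - ∑ i, x i) ^ α * ∏ i, x i ^ q i
  have hf : AEStronglyMeasurable f (volume.restrict (openSimplex m 1)) :=
    Measurable.aestronglyMeasurable (by fun_prop)
  have hnonneg : 0 ≤ᵐ[volume.restrict (openSimplex m 1)] f :=
    ae_restrict_of_forall_mem (measurableSet_openSimplex m 1) fun x hx =>
      mul_nonneg (Real.rpow_nonneg (sub_nonneg.2 hx.2.le) α)
        (Finset.prod_nonneg fun i _ => Real.rpow_nonneg (hx.1 i).le (q i))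
  have hlint := lintegral_dirichlet m hα (fun i => neg_one_lt_zero.trans (hq i)) one_pos
  rw [Real.one_rpow, one_mul] at hlint
  have hΓ : 0 ≤ (∏ i, Real.Gamma (q i + 1)) * Real.Gamma (α + 1) /
      Real.Gamma (α + (∑ i, q i) + m + 1) := by
    have hsum : 0 ≤ ∑ i, q i := Finset.sum_nonneg fun i _ => (hq i).le
    have hm0 : (0 : ℝ) ≤ m := m.cast_nonneg
    exact div_nonneg (mul_nonneg
      (Finset.prod_nonneg fun i _ => Real.Gamma_nonneg_of_nonneg (by linarith [hq i]))
      (Real.Gamma_nonneg_of_nonneg (by linarith))) (Real.Gamma_nonneg_of_nonneg (by linarith))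
  refine ⟨⟨hf, (hasFiniteIntegral_iff_ofReal hnonneg).2 ?_⟩,
    (integral_eq_lintegral_of_nonneg_ae hnonneg hf).trans ?_⟩
  · exact hlint.trans_lt ENNReal.ofReal_lt_top
  · exact (congrArg ENNReal.toReal hlint).trans (ENNReal.toReal_ofReal hΓ)
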